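/- Let d ≥ 1, let S ⊆ B_{2r_d}(0) be measurable with vol(S) > 0, and let λ > 0. Then the expected packing density of the hard sphere model on S satisfies α_S(λ) ≥ λ · exp(−2 λ · 3^{d/2}). -/

import Mathlib

open MeasureTheory Filter

/-- `rd d` is the radius of a Euclidean ball of volume 1 in `ℝ^d`. -/
noncomputable def rd (d : ℕ) : ℝ :=
  ((volume (Metric.closedBall (0 : EuclideanSpace ℝ (Fin d)) 1)).toReal) ^ (-(1 : ℝ) / d)

/-- The set of `k`-tuples of points of `S` with pairwise distances `> 2 r_d`,
i.e. centers of packings by balls of volume 1. -/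
def packSet (d k : ℕ) (S : Set (EuclideanSpace ℝ (Fin d))) :
    Set (Fin k → EuclideanSpace ℝ (Fin d)) :=
  {x | (∀ i, x i ∈ S) ∧ ∀ i j, i ≠ j → dist (x i) (x j) > 2 * rd d}

/-- The canonical hard sphere partition function `Ẑ_S(k)`. -/
noncomputable def Zhat (d : ℕ) (S : Set (EuclideanSpace ℝ (Fin d))) (k : ℕ) : ℝ :=
  (1 / (Nat.factorial k : ℝ)) *
    ∫ x : Fin k → EuclideanSpace ℝ (Fin d),
      Set.indicator (packSet d k S) (fun _ => (1 : ℝ)) x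

/-- The grand canonical hard sphere partition function `Z_S(λ)`. -/
noncomputable def Zgc (d : ℕ) (S : Set (EuclideanSpace ℝ (Fin d))) (lam : ℝ) : ℝ :=
  ∑' k : ℕ, lam ^ k * Zhat d S k

/-- The expected packing density `α_S(λ)` of the hard sphere model. -/
noncomputable def alphaS (d : ℕ) (S : Set (EuclideanSpace ℝ (Fin d))) (lam : ℝ) : ℝ :=
  (∑' k : ℕ, (k : ℝ) * lam ^ k * Zhat d S k) / ((volume S).toReal * Zgc d S lam)

/-- `Bn d n` is the closed ball of volume `n` centered at the origin in `ℝ^d`. -/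
noncomputable def Bn (d : ℕ) (n : ℝ) : Set (EuclideanSpace ℝ (Fin d)) :=
  Metric.closedBall 0 (n ^ ((1 : ℝ) / d) * rd d)

/-- The maximum number of centers of a packing of `B_n` by balls of volume 1. -/
noncomputable def Md (d : ℕ) (n : ℝ) : ℝ :=
  sSup {m : ℝ | ∃ X : Finset (EuclideanSpace ℝ (Fin d)),
    (∀ x ∈ X, x ∈ Bn d n) ∧ (∀ x ∈ X, ∀ y ∈ X, x ≠ y → dist x y > 2 * rd d) ∧
    m = (X.card : ℝ)}

/-- The externally uncovered region `T(v,X)` for a configuration `X = (x_1,…,x_k)`. -/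
def Treg (d : ℕ) (S : Set (EuclideanSpace ℝ (Fin d))) (v : EuclideanSpace ℝ (Fin d))
    {k : ℕ} (x : Fin k → EuclideanSpace ℝ (Fin d)) : Set (EuclideanSpace ℝ (Fin d)) :=
  {p | p ∈ Metric.closedBall v (2 * rd d) ∩ S ∧
    ∀ i, dist (x i) v > 2 * rd d → dist p (x i) > 2 * rd d}

/-- The expectation of a functional `g(v, X)` under the two-part experiment:
`X` drawn from the hard sphere model on `S` at fugacity `λ`, and independently
`v` uniform in `S`. -/
noncomputable def ExpT (d : ℕ) (S : Set (EuclideanSpace ℝ (Fin d))) (lam : ℝ)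
    (g : EuclideanSpace ℝ (Fin d) → ∀ k : ℕ, (Fin k → EuclideanSpace ℝ (Fin d)) → ℝ) : ℝ :=
  (1 / ((volume S).toReal * Zgc d S lam)) *
    ∑' k : ℕ, (lam ^ k / (Nat.factorial k : ℝ)) *
      ∫ v in S, ∫ x : Fin k → EuclideanSpace ℝ (Fin d),
        Set.indicator (packSet d k S) (fun y => g v k y) x

section aux

open scoped ENNReal

variable {d : ℕ}

/-- volume of the packing set -/
noncomputable def WW (d k : ℕ) (S : Set (EuclideanSpace ℝ (Fin d))) : ℝ≥0∞ :=
  volume (packSet d k S)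

lemma packSet_meas (k : ℕ) {S : Set (EuclideanSpace ℝ (Fin d))} (hM : MeasurableSet S) :
    MeasurableSet (packSet d k S) := by
  unfold packSet
  simp only [Set.ofPred_and, Set.ofPred_forall]
  refine MeasurableSet.inter ?_ ?_
  · exact MeasurableSet.iInter fun i => (measurable_pi_apply i) hM
  · refine MeasurableSet.iInter fun i => MeasurableSet.iInter fun j => MeasurableSet.iInter fun _ => ?_
    exact measurableSet_lt measurable_const
      ((measurable_pi_apply i).dist (measurable_pi_apply j))

lemma WW_zero (S : Set (EuclideanSpace ℝ (Fin d))) : WW d 0 S = 1 := by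
  have : packSet d 0 S = Set.univ := by
    ext x; simp [packSet]
  unfold WW
  rw [this]
  simp [volume_pi]

/-- the joint set -/
def joint (d k : ℕ) (S : Set (EuclideanSpace ℝ (Fin d))) :
    Set (EuclideanSpace ℝ (Fin d) × (Fin k → EuclideanSpace ℝ (Fin d))) :=
  {p | p.2 ∈ packSet d k S ∧ ∀ i, dist (p.2 i) p.1 > 2 * rd d}

lemma joint_meas (k : ℕ) {S : Set (EuclideanSpace ℝ (Fin d))} (hM : MeasurableSet S) :
    MeasurableSet (joint d k S) := by
  unfold joint
  simp only [Set.ofPred_and, Set.ofPred_forall]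
  refine MeasurableSet.inter (measurable_snd (packSet_meas k hM)) ?_
  refine MeasurableSet.iInter fun i => ?_
  exact measurableSet_lt measurable_const
      (((measurable_pi_apply i).comp measurable_snd).dist measurable_fst)

lemma joint_section (k : ℕ) (S : Set (EuclideanSpace ℝ (Fin d))) (v : EuclideanSpace ℝ (Fin d)) :
    Prod.mk v ⁻¹' (joint d k S) = packSet d k (S \ Metric.closedBall v (2 * rd d)) := by
  ext x
  simp only [joint, packSet, Set.mem_preimage, Set.mem_ofPred_eq, Set.mem_sdiff,
    Metric.mem_closedBall, not_le, forall_and, gt_iff_lt]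
  tauto

lemma WW_section_meas (k : ℕ) {S : Set (EuclideanSpace ℝ (Fin d))} (hM : MeasurableSet S) :
    Measurable fun v => WW d k (S \ Metric.closedBall v (2 * rd d)) := by
  have := measurable_measure_prodMk_left (ν := (volume : Measure (Fin k → EuclideanSpace ℝ (Fin d))))
    (joint_meas k hM)
  simpa only [joint_section, WW] using this

lemma WW_succ (k : ℕ) {S : Set (EuclideanSpace ℝ (Fin d))} (hM : MeasurableSet S) :
    WW d (k+1) S = ∫⁻ v in S, WW d k (S \ Metric.closedBall v (2 * rd d)) := by
  have hmp := volume_preserving_piFinSuccAbove (fun _ : Fin (k+1) => EuclideanSpace ℝ (Fin d)) 0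
  have hset : packSet d (k+1) S =
      (MeasurableEquiv.piFinSuccAbove (fun _ : Fin (k+1) => EuclideanSpace ℝ (Fin d)) 0) ⁻¹'
        ((S ×ˢ Set.univ) ∩ joint d k S) := by
    ext x
    simp only [packSet, joint, Set.mem_ofPred_eq, Set.mem_preimage, Set.mem_inter_iff,
      Set.mem_prod, Set.mem_univ, MeasurableEquiv.piFinSuccAbove_apply, Fin.insertNthEquiv_symm_apply,
      Fin.removeNth_zero, Fin.tail, Fin.forall_fin_succ, dist_comm (x 0)]
    simp [Fin.succ_ne_zero, (Fin.succ_ne_zero _).symm, forall_and]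
    tauto
  unfold WW
  rw [hset, hmp.measure_preimage
    ((hM.prod MeasurableSet.univ).inter (joint_meas k hM)).nullMeasurableSet]
  rw [Measure.volume_eq_prod, Measure.prod_apply ((hM.prod MeasurableSet.univ).inter (joint_meas k hM)),
    ← lintegral_indicator hM]
  congr 1
  ext v
  by_cases h : v ∈ S
  · simp [h, joint_section]
  · simp [h]

lemma WW_mono (k : ℕ) {S T : Set (EuclideanSpace ℝ (Fin d))} (h : S ⊆ T) : WW d k S ≤ WW d k T :=
  measure_mono fun _ hx => ⟨fun i => h (hx.1 i), hx.2⟩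

lemma WW_le (k : ℕ) {S : Set (EuclideanSpace ℝ (Fin d))} (hM : MeasurableSet S) :
    WW d k S ≤ volume S ^ k := by
  induction k with
  | zero => simp [WW_zero]
  | succ k ih =>
    rw [WW_succ k hM]
    calc _ ≤ ∫⁻ v in S, volume S ^ k :=
          lintegral_mono fun v => (WW_mono k Set.sdiff_subset).trans ih
      _ = _ := by simp [pow_succ]

lemma WW_union (k : ℕ) (b : ℝ≥0∞) : ∀ {A B : Set (EuclideanSpace ℝ (Fin d))},
    MeasurableSet A → MeasurableSet B → volume B ≤ b → Disjoint A B →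
    WW d k (A ∪ B) ≤ ∑ p ∈ Finset.HasAntidiagonal.antidiagonal k, (k.choose p.1 : ℝ≥0∞) * (WW d p.1 A * b ^ p.2) := by
  induction k with
  | zero => intro A B _ _ _ _; simp [WW_zero]
  | succ k ih =>
    intro A B hA hB hb hAB
    rw [WW_succ k (hA.union hB), lintegral_union hB hAB,
      Finset.sum_antidiagonal_choose_succ_mul (fun i j => WW d i A * b ^ j), add_comm]
    refine add_le_add ?_ ?_
    · calc _ ≤ ∫⁻ v in B, WW d k (A ∪ B) := lintegral_mono fun v => WW_mono k Set.sdiff_subset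
        _ = WW d k (A ∪ B) * volume B := by simp
        _ ≤ (∑ p ∈ Finset.HasAntidiagonal.antidiagonal k, (k.choose p.1 : ℝ≥0∞) * (WW d p.1 A * b ^ p.2)) * b :=
          mul_le_mul' (ih hA hB hb hAB) hb
        _ = _ := by
          rw [Finset.sum_mul]
          refine Finset.sum_congr rfl fun p _ => ?_
          rw [pow_succ]; ring
    · calc _ ≤ ∫⁻ v in A, ∑ p ∈ Finset.HasAntidiagonal.antidiagonal k, (k.choose p.1 : ℝ≥0∞) *
                (WW d p.1 (A \ Metric.closedBall v (2 * rd d)) * b ^ p.2) := by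
            refine lintegral_mono fun v => ?_
            simp only [Set.union_diff_distrib]
            exact ih (hA.diff Metric.isClosed_closedBall.measurableSet)
              (hB.diff Metric.isClosed_closedBall.measurableSet)
              ((measure_mono Set.sdiff_subset).trans hb)
              (hAB.mono Set.sdiff_subset Set.sdiff_subset)
        _ = _ := by
          rw [lintegral_finsetSum]
          · refine Finset.sum_congr rfl fun p hp => ?_
            rw [lintegral_const_mul, lintegral_mul_const, WW_succ _ hA,
              Nat.choose_symm_of_eq_add (Finset.HasAntidiagonal.mem_antidiagonal.1 hp).symm]
            · exact WW_section_meas _ hA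
            · exact (WW_section_meas _ hA).mul_const _
          · intro p _
            exact ((WW_section_meas _ hA).mul_const _).const_mul _

/-- coefficients -/
noncomputable def cc (lam : ℝ) (k : ℕ) : ℝ≥0∞ := ENNReal.ofReal (lam ^ k / (k.factorial : ℝ))

/-- extended partition function -/
noncomputable def GG (d : ℕ) (lam : ℝ) (S : Set (EuclideanSpace ℝ (Fin d))) : ℝ≥0∞ :=
  ∑' k, cc lam k * WW d k S

lemma cc_choose {lam : ℝ} (hl : 0 < lam) {k i j : ℕ} (h : i + j = k) :
    cc lam k * (k.choose i : ℝ≥0∞) = cc lam i * cc lam j := by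
  unfold cc
  rw [← ENNReal.ofReal_natCast, ← ENNReal.ofReal_mul (by positivity),
    ← ENNReal.ofReal_mul (by positivity)]
  congr 1
  subst h
  have := Nat.add_choose_mul_factorial_mul_factorial i j
  rw [Nat.choose_symm_add.symm] at this
  have h2 : ((i+j).choose i : ℝ) * i.factorial * j.factorial = (i+j).factorial := by
    exact_mod_cast this
  have h0 : ((i+j).factorial : ℝ) ≠ 0 := by positivity
  field_simp
  rw [← h2]; ring

lemma exp_tsum {lam : ℝ} (hl : 0 < lam) {b : ℝ} (hb : 0 ≤ b) :
    ∑' k, cc lam k * (ENNReal.ofReal b) ^ k = ENNReal.ofReal (Real.exp (lam * b)) := by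
  have hs := Real.summable_pow_div_factorial (lam * b)
  rw [Real.exp_eq_exp_ℝ, NormedSpace.exp_eq_tsum_div (𝔸 := ℝ),
    ENNReal.ofReal_tsum_of_nonneg (fun n => by positivity) hs]
  congr 1
  ext k
  rw [cc, ← ENNReal.ofReal_pow hb, ← ENNReal.ofReal_mul (by positivity)]
  congr 1
  rw [mul_pow]; ring

lemma GG_union {lam : ℝ} (hl : 0 < lam) {A B : Set (EuclideanSpace ℝ (Fin d))}
    (hA : MeasurableSet A) (hB : MeasurableSet B) (hAB : Disjoint A B) (hf : volume B ≠ ∞) :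
    GG d lam (A ∪ B) ≤ GG d lam A * ENNReal.ofReal (Real.exp (lam * (volume B).toReal)) := by
  rw [← exp_tsum hl ENNReal.toReal_nonneg, ENNReal.ofReal_toReal hf]
  calc _ ≤ ∑' k, ∑ p ∈ Finset.HasAntidiagonal.antidiagonal k, (cc lam p.1 * WW d p.1 A) *
            (cc lam p.2 * volume B ^ p.2) := by
        refine ENNReal.tsum_le_tsum fun k => ?_
        refine (mul_le_mul_right (WW_union k (volume B) hA hB le_rfl hAB) _).trans ?_
        rw [Finset.mul_sum]
        refine Finset.sum_le_sum fun p hp => ?_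
        rw [← mul_assoc, cc_choose hl (Finset.HasAntidiagonal.mem_antidiagonal.1 hp)]
        apply le_of_eq; ring
    _ = ∑' q : ℕ × ℕ, (cc lam q.1 * WW d q.1 A) * (cc lam q.2 * volume B ^ q.2) := by
        rw [← Finset.HasAntidiagonal.sigmaAntidiagonalEquivProd.tsum_eq, ENNReal.tsum_sigma']
        congr 1; ext k
        rw [tsum_fintype]
        exact (Finset.sum_coe_sort (Finset.HasAntidiagonal.antidiagonal k)
          (fun p => (cc lam p.1 * WW d p.1 A) * (cc lam p.2 * volume B ^ p.2))).symm
    _ = _ := by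
        rw [ENNReal.tsum_prod' ]
        simp only [ENNReal.tsum_mul_left, ENNReal.tsum_mul_right]
        rfl

lemma GG_le {lam : ℝ} (hl : 0 < lam) {S : Set (EuclideanSpace ℝ (Fin d))}
    (hM : MeasurableSet S) (hf : volume S ≠ ∞) : GG d lam S < ∞ := by
  refine lt_of_le_of_lt ?_ (ENNReal.ofReal_lt_top (r := Real.exp (lam * (volume S).toReal)))
  rw [← exp_tsum hl ENNReal.toReal_nonneg, ENNReal.ofReal_toReal hf]
  exact ENNReal.tsum_le_tsum fun k => mul_le_mul_right (WW_le k hM) _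

lemma one_le_GG {lam : ℝ} (S : Set (EuclideanSpace ℝ (Fin d))) : 1 ≤ GG d lam S := by
  refine le_trans ?_ (ENNReal.le_tsum 0)
  simp [cc, WW_zero]

lemma Zhat_eq (S : Set (EuclideanSpace ℝ (Fin d))) (hM : MeasurableSet S) (k : ℕ) :
    Zhat d S k = (1 / (Nat.factorial k : ℝ)) * (WW d k S).toReal := by
  unfold Zhat WW
  rw [integral_indicator_const _ (packSet_meas k hM)]
  simp [Measure.real]

lemma Zgc_eq {lam : ℝ} (hl : 0 < lam) {S : Set (EuclideanSpace ℝ (Fin d))}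
    (hM : MeasurableSet S) (hf : volume S ≠ ∞) : Zgc d S lam = (GG d lam S).toReal := by
  unfold Zgc GG
  rw [ENNReal.tsum_toReal_eq]
  · congr 1; ext k
    rw [Zhat_eq S hM, cc, ENNReal.toReal_mul, ENNReal.toReal_ofReal (by positivity)]
    ring
  · intro k
    exact ne_top_of_le_ne_top (GG_le hl hM hf).ne (ENNReal.le_tsum k)

lemma num_eq {lam : ℝ} (hl : 0 < lam) {S : Set (EuclideanSpace ℝ (Fin d))}
    (hM : MeasurableSet S) (hf : volume S ≠ ∞) :
    ∑' k : ℕ, (k : ℝ) * lam ^ k * Zhat d S k =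
      lam * (∫⁻ v in S, GG d lam (S \ Metric.closedBall v (2 * rd d))).toReal := by
  have h1 : ∫⁻ v in S, GG d lam (S \ Metric.closedBall v (2 * rd d)) =
      ∑' k, cc lam k * WW d (k+1) S := by
    unfold GG
    rw [lintegral_tsum fun k => ((WW_section_meas k hM).const_mul _).aemeasurable]
    congr 1; ext k
    rw [lintegral_const_mul _ (WW_section_meas k hM), WW_succ k hM]
  have hfin : ∀ k, WW d k S ≠ ∞ := fun k =>
    ne_top_of_le_ne_top (ENNReal.pow_ne_top hf) (WW_le k hM)
  rw [h1, ENNReal.tsum_toReal_eq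
    (fun k => ENNReal.mul_ne_top (a := cc lam k) ENNReal.ofReal_ne_top (hfin (k+1))), ← tsum_mul_left]
  have hterm : ∀ k : ℕ, lam * (cc lam k * WW d (k+1) S).toReal =
      ((k+1 : ℕ) : ℝ) * lam ^ (k+1) * Zhat d S (k+1) := by
    intro k
    rw [Zhat_eq S hM, cc, ENNReal.toReal_mul, ENNReal.toReal_ofReal (by positivity),
      Nat.factorial_succ]
    push_cast
    field_simp
    ring
  simp only [hterm]
  have := (Function.Injective.tsum_eq (g := fun k : ℕ => k + 1)
    (f := fun k : ℕ => (k : ℝ) * lam ^ k * Zhat d S k) (add_left_injective 1) ?_)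
  · exact this.symm
  · intro k hk
    rcases k with _ | k
    · simp at hk
    · exact ⟨k, rfl⟩

lemma rd_pos (hd : 1 ≤ d) : 0 < rd d := by
  unfold rd
  apply Real.rpow_pos_of_pos
  apply ENNReal.toReal_pos
  · exact (Metric.measure_closedBall_pos _ _ one_pos).ne'
  · exact measure_closedBall_lt_top.ne

lemma vol_ball (hd : 1 ≤ d) (c : EuclideanSpace ℝ (Fin d)) :
    volume (Metric.closedBall c (√3 * rd d)) = ENNReal.ofReal ((3 : ℝ) ^ ((d : ℝ) / 2)) := by
  have hr := rd_pos hd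
  rw [Measure.addHaar_closedBall' _ _ (by positivity)]
  have hfin : volume (Metric.closedBall (0 : EuclideanSpace ℝ (Fin d)) 1) ≠ ∞ :=
    measure_closedBall_lt_top.ne
  have hpos : 0 < (volume (Metric.closedBall (0 : EuclideanSpace ℝ (Fin d)) 1)).toReal :=
    ENNReal.toReal_pos (Metric.measure_closedBall_pos _ _ one_pos).ne' hfin
  rw [← ENNReal.ofReal_toReal hfin, ← ENNReal.ofReal_mul (by positivity)]
  congr 1
  have hd0 : (d : ℝ) ≠ 0 := by positivity
  have h1 : rd d ^ d = (volume (Metric.closedBall (0 : EuclideanSpace ℝ (Fin d)) 1)).toReal⁻¹ := by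
    unfold rd
    rw [← Real.rpow_natCast, ← Real.rpow_mul hpos.le, div_mul_cancel₀ _ hd0, Real.rpow_neg_one]
  have h2 : (√3 : ℝ) ^ d = (3 : ℝ) ^ ((d : ℝ) / 2) := by
    rw [Real.sqrt_eq_rpow, ← Real.rpow_natCast, ← Real.rpow_mul (by norm_num)]
    congr 1; ring
  rw [finrank_euclideanSpace_fin, mul_pow, h1, h2, mul_assoc, inv_mul_cancel₀ hpos.ne', mul_one]

lemma geom {R : ℝ} {u v : EuclideanSpace ℝ (Fin d)} (hr : 0 < R)
    (hu : ‖u‖ ≤ 2 * R) (hvu : ‖v‖ ≤ ‖u‖) (h : dist v u ≤ 2 * R) :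
    v ∈ Metric.closedBall ((1/2 : ℝ) • u) (√3 * R) := by
  rw [Metric.mem_closedBall, dist_eq_norm]
  rw [dist_eq_norm] at h
  apply le_of_sq_le_sq _ (by positivity)
  have e1 : ‖v - u‖^2 = ‖v‖^2 - 2 * inner ℝ v u + ‖u‖^2 := norm_sub_sq_real v u
  have e2 : ‖v - (1/2 : ℝ) • u‖^2 = ‖v‖^2 - 2 * inner ℝ v ((1/2 : ℝ) • u) + ‖(1/2 : ℝ) • u‖^2 :=
    norm_sub_sq_real v _
  rw [inner_smul_right, norm_smul] at e2
  rw [e2, mul_pow (√3), Real.sq_sqrt (by norm_num)]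
  norm_num
  have a1 : ‖v - u‖^2 ≤ (2*R)^2 := by gcongr
  have a2 : ‖v‖^2 ≤ ‖u‖^2 := by gcongr
  have a3 : ‖u‖^2 ≤ (2*R)^2 := by gcongr
  nlinarith

lemma double_bound (hd : 1 ≤ d) {S : Set (EuclideanSpace ℝ (Fin d))}
    (hS : S ⊆ Metric.closedBall 0 (2 * rd d)) (hM : MeasurableSet S) :
    ∫⁻ v in S, volume (S ∩ Metric.closedBall v (2 * rd d)) ≤
      2 * ENNReal.ofReal ((3 : ℝ) ^ ((d : ℝ) / 2)) * volume S := by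
  set P : Set (EuclideanSpace ℝ (Fin d) × EuclideanSpace ℝ (Fin d)) :=
    {p | (p.1 ∈ S ∧ p.2 ∈ S) ∧ dist p.2 p.1 ≤ 2 * rd d} with hP
  set Q : Set (EuclideanSpace ℝ (Fin d) × EuclideanSpace ℝ (Fin d)) :=
    {p | ((p.1 ∈ S ∧ p.2 ∈ S) ∧ dist p.2 p.1 ≤ 2 * rd d) ∧ ‖p.2‖ ≤ ‖p.1‖} with hQ
  have hPm : MeasurableSet P :=
    ((measurable_fst hM).inter (measurable_snd hM)).inter
      (measurableSet_le (measurable_snd.dist measurable_fst) measurable_const)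
  have hQm : MeasurableSet Q := hPm.inter
    (measurableSet_le measurable_snd.norm measurable_fst.norm)
  have h1 : ∫⁻ v in S, volume (S ∩ Metric.closedBall v (2 * rd d)) =
      ((volume : Measure (EuclideanSpace ℝ (Fin d))).prod volume) P := by
    rw [Measure.prod_apply hPm, ← lintegral_indicator hM]
    congr 1; ext v
    by_cases h : v ∈ S
    · simp only [Set.indicator_of_mem h]
      congr 1; ext x
      simp [hP, h]
    · simp [hP, h]
  have h2 : P ⊆ Q ∪ Prod.swap ⁻¹' Q := by
    rintro ⟨u, v⟩ ⟨⟨hu, hv⟩, hd⟩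
    rcases le_total ‖v‖ ‖u‖ with h | h
    · exact Or.inl ⟨⟨⟨hu, hv⟩, hd⟩, h⟩
    · exact Or.inr ⟨⟨⟨hv, hu⟩, by simpa [dist_comm] using hd⟩, h⟩
  have h3 : ((volume : Measure (EuclideanSpace ℝ (Fin d))).prod volume) (Prod.swap ⁻¹' Q) =
      ((volume : Measure (EuclideanSpace ℝ (Fin d))).prod volume) Q :=
    (Measure.measurePreserving_swap).measure_preimage hQm.nullMeasurableSet
  have h4 : ((volume : Measure (EuclideanSpace ℝ (Fin d))).prod volume) Q ≤
      ENNReal.ofReal ((3 : ℝ) ^ ((d : ℝ) / 2)) * volume S := by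
    rw [Measure.prod_apply hQm, ← setLIntegral_const, ← lintegral_indicator hM]
    refine lintegral_mono fun u => ?_
    by_cases h : u ∈ S
    · simp only [Set.indicator_of_mem h]
      rw [← vol_ball hd ((1/2 : ℝ) • u)]
      refine measure_mono ?_
      rintro v ⟨⟨⟨_, _⟩, h5⟩, h6⟩
      exact geom (rd_pos hd) (by simpa using hS h) h6 h5
    · simp [hQ, h]
  rw [h1]
  calc _ ≤ _ := measure_mono h2
    _ ≤ _ := measure_union_le _ _
    _ ≤ ENNReal.ofReal ((3 : ℝ) ^ ((d : ℝ) / 2)) * volume S +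
        ENNReal.ofReal ((3 : ℝ) ^ ((d : ℝ) / 2)) * volume S := by
      rw [h3]; exact add_le_add h4 h4
    _ = _ := by ring

end aux

/-- for measurable `S ⊆ B_{2 r_d}(0)` of positive volume and `λ > 0`,
`α_S(λ) ≥ λ exp(-2 λ 3^{d/2})`. -/
theorem alphaS_lower_bound_small_S (d : ℕ) (hd : 1 ≤ d)
    (S : Set (EuclideanSpace ℝ (Fin d)))
    (hS : S ⊆ Metric.closedBall 0 (2 * rd d)) (hM : MeasurableSet S)
    (hv : 0 < volume S) (lam : ℝ) (hlam : 0 < lam) :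
    alphaS d S lam ≥ lam * Real.exp (-(2 * lam * (3 : ℝ) ^ ((d : ℝ) / 2))) := by
  have hf : volume S ≠ ⊤ := ((measure_mono hS).trans_lt measure_closedBall_lt_top).ne
  have hVpos : 0 < (volume S).toReal := ENNReal.toReal_pos hv.ne' hf
  have hGfin := GG_le hlam hM hf
  have hGpos : 0 < (GG d lam S).toReal :=
    ENNReal.toReal_pos (zero_lt_one.trans_le (one_le_GG S)).ne' hGfin.ne
  set c : ℝ := 2 * (3 : ℝ) ^ ((d : ℝ) / 2) with hc
  set m : EuclideanSpace ℝ (Fin d) → ℝ :=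
    fun v => (volume (S ∩ Metric.closedBall v (2 * rd d))).toReal with hm
  have hfinv : ∀ v, volume (S ∩ Metric.closedBall v (2 * rd d)) ≠ ⊤ := fun v =>
    ne_top_of_le_ne_top hf (measure_mono Set.inter_subset_left)
  have hmeasE : Measurable fun v => volume (S ∩ Metric.closedBall v (2 * rd d)) := by
    have hPm : MeasurableSet {p : EuclideanSpace ℝ (Fin d) × EuclideanSpace ℝ (Fin d) |
        p.2 ∈ S ∧ dist p.2 p.1 ≤ 2 * rd d} :=
      (measurable_snd hM).inter
        (measurableSet_le (measurable_snd.dist measurable_fst) measurable_const)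
    exact measurable_measure_prodMk_left (ν := volume) hPm
  have hmeas : Measurable m := hmeasE.ennreal_toReal
  have hmnn : ∀ v, 0 ≤ m v := fun v => ENNReal.toReal_nonneg
  have hmle : ∀ v, m v ≤ (volume S).toReal := fun v =>
    ENNReal.toReal_mono hf (measure_mono Set.inter_subset_left)
  haveI : IsFiniteMeasure (volume.restrict S) := ⟨by simpa using hf.lt_top⟩
  have hmint : Integrable m (volume.restrict S) :=
    Integrable.of_bound hmeas.aestronglyMeasurable (volume S).toReal
      (Filter.Eventually.of_forall fun v => by
        rw [Real.norm_of_nonneg (hmnn v)]; exact hmle v)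
  have hmI : ∫ v in S, m v ≤ c * (volume S).toReal := by
    rw [hm, integral_toReal hmeasE.aemeasurable
      (Filter.Eventually.of_forall fun v => (hfinv v).lt_top)]
    have := ENNReal.toReal_mono (ENNReal.mul_ne_top
      (ENNReal.mul_ne_top ENNReal.ofNat_ne_top ENNReal.ofReal_ne_top) hf) (double_bound hd hS hM)
    rwa [ENNReal.toReal_mul, ENNReal.toReal_mul, ENNReal.toReal_ofReal (by positivity)] at this
  have hexpint : Integrable (fun v => Real.exp (-(lam * m v))) (volume.restrict S) :=
    Integrable.of_bound (by fun_prop) 1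
      (Filter.Eventually.of_forall fun v => by
        rw [Real.norm_of_nonneg (Real.exp_pos _).le, Real.exp_le_one_iff]
        have := mul_nonneg hlam.le (hmnn v)
        linarith)
  -- Jensen via a tangent line
  have hJ : Real.exp (-(lam * c)) * (volume S).toReal ≤ ∫ v in S, Real.exp (-(lam * m v)) := by
    have hli : Integrable (fun v => Real.exp (-(lam * c)) * ((1 + lam * c) - lam * m v))
        (volume.restrict S) := ((integrable_const _).sub (hmint.const_mul _)).const_mul _
    have h1 : ∫ v in S, Real.exp (-(lam * c)) * ((1 + lam * c) - lam * m v) ≤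
        ∫ v in S, Real.exp (-(lam * m v)) := by
      refine integral_mono hli hexpint fun v => ?_
      have h2 : Real.exp (-(lam * m v)) =
          Real.exp (-(lam * c)) * Real.exp (lam * c - lam * m v) := by
        rw [← Real.exp_add]; congr 1; ring
      simp only [h2]
      refine mul_le_mul_of_nonneg_left ?_ (Real.exp_pos _).le
      have := Real.add_one_le_exp (lam * c - lam * m v)
      linarith
    refine le_trans ?_ h1
    rw [integral_const_mul, integral_sub (integrable_const _) (hmint.const_mul _),
      integral_const_mul]
    simp only [integral_const, Measure.restrict_apply_univ,
      smul_eq_mul, Measure.real]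
    refine mul_le_mul_of_nonneg_left ?_ (Real.exp_pos _).le
    have := mul_le_mul_of_nonneg_left hmI hlam.le
    nlinarith
  have hpt : ∀ v, GG d lam S * ENNReal.ofReal (Real.exp (-(lam * m v))) ≤
      GG d lam (S \ Metric.closedBall v (2 * rd d)) := by
    intro v
    have h1 := GG_union (d := d) hlam (hM.diff (Metric.isClosed_closedBall (x := v) (ε := 2 * rd d)).measurableSet)
      (hM.inter (Metric.isClosed_closedBall (x := v) (ε := 2 * rd d)).measurableSet)
      (Set.disjoint_sdiff_inter) (hfinv v)
    rw [Set.sdiff_union_inter] at h1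
    refine (mul_le_mul_left h1 _).trans ?_
    rw [mul_assoc, ← ENNReal.ofReal_mul (Real.exp_pos _).le, ← Real.exp_add]
    simp [hm]
  have hbig : GG d lam S * ENNReal.ofReal (∫ v in S, Real.exp (-(lam * m v))) ≤
      ∫⁻ v in S, GG d lam (S \ Metric.closedBall v (2 * rd d)) := by
    rw [ofReal_integral_eq_lintegral_ofReal hexpint
      (Filter.Eventually.of_forall fun v => (Real.exp_pos _).le),
      ← lintegral_const_mul' _ _ hGfin.ne]
    exact lintegral_mono hpt
  have hfinI : ∫⁻ v in S, GG d lam (S \ Metric.closedBall v (2 * rd d)) ≠ ⊤ := by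
    refine ne_top_of_le_ne_top (ENNReal.mul_ne_top hGfin.ne hf)
      (le_trans (lintegral_mono (g := fun _ => GG d lam S) fun v => ?_) (by simp))
    exact ENNReal.tsum_le_tsum fun k => mul_le_mul_right (WW_mono k Set.sdiff_subset) _
  have hbig2 := ENNReal.toReal_mono hfinI hbig
  rw [ENNReal.toReal_mul, ENNReal.toReal_ofReal
    (integral_nonneg fun v => (Real.exp_pos _).le)] at hbig2
  unfold alphaS
  rw [num_eq hlam hM hf, Zgc_eq hlam hM hf, ge_iff_le, le_div_iff₀ (by positivity)]
  have he : -(2 * lam * (3 : ℝ) ^ ((d : ℝ) / 2)) = -(lam * c) := by rw [hc]; ring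
  rw [he, mul_assoc]
  refine mul_le_mul_of_nonneg_left (le_trans ?_ hbig2) hlam.le
  have := mul_le_mul_of_nonneg_left hJ hGpos.le
  linarith
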